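/- An R-module E is FP_n^{≤d}-injective if and only if Ext^1_R(P/N, E) = 0 for every projective R-module P and every submodule N ⊆ P that is finitely (n-1)-presented with projective dimension at most d-1. -/

import Mathlib

universe u

/-- `M` is a finitely `n`-presented `R`-module. -/
def FinNPres (R : Type u) [Ring R] : ℕ → (M : Type u) → [AddCommGroup M] → [Module R M] → Prop
  | 0, M, _, _ => Module.Finite R M
  | n+1, M, _, _ => ∃ (k : ℕ) (f : (Fin k → R) →ₗ[R] M), Function.Surjective f ∧
      FinNPres R n (LinearMap.ker f)

/-- `M` has projective dimension at most `d` (finite `d`). -/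
def ProjDimLE (R : Type u) [Ring R] : ℕ → (M : Type u) → [AddCommGroup M] → [Module R M] → Prop
  | 0, M, _, _ => Module.Projective R M
  | d+1, M, _, _ => ∃ (ι : Type u) (f : (ι →₀ R) →ₗ[R] M), Function.Surjective f ∧
      ProjDimLE R d (LinearMap.ker f)

/-- Projective dimension at most `d` for `d : ℕ∞`; `d = ⊤` imposes no condition. -/
def ProjDimLE' (R : Type u) [Ring R] (d : ℕ∞) (M : Type u) [AddCommGroup M] [Module R M] : Prop :=
  ∀ k : ℕ, (k : ℕ∞) = d → ProjDimLE R k M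

/-- `Ext¹_R(M, N) = 0`, expressed by the splitting of all extensions of `M` by `N`. -/
def Ext1Zero (R : Type u) [Ring R] (M N : Type u) [AddCommGroup M] [Module R M]
    [AddCommGroup N] [Module R N] : Prop :=
  ∀ (X : Type u) [AddCommGroup X] [Module R X] (i : N →ₗ[R] X) (p : X →ₗ[R] M),
    Function.Injective i → Function.Surjective p → LinearMap.range i = LinearMap.ker p →
    ∃ r : X →ₗ[R] N, r ∘ₗ i = LinearMap.id

/-- `N` is `FPₙ^{≤d}`-injective: `Ext¹_R(K, N) = 0` for every finitely `n`-presented `K`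
of projective dimension at most `d`. -/
def FPdInj (R : Type u) [Ring R] (n : ℕ) (d : ℕ∞) (N : Type u)
    [AddCommGroup N] [Module R N] : Prop :=
  ∀ (K : Type u) [AddCommGroup K] [Module R K],
    FinNPres R n K → ProjDimLE' R d K → Ext1Zero R K N

/-- `M` is `FPₙ^{≤d}`-projective: `Ext¹_R(M, N) = 0` for every `FPₙ^{≤d}`-injective `N`. -/
def FPdProj (R : Type u) [Ring R] (n : ℕ) (d : ℕ∞) (M : Type u)
    [AddCommGroup M] [Module R M] : Prop :=
  ∀ (N : Type u) [AddCommGroup N] [Module R N], FPdInj R n d N → Ext1Zero R M N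


open CategoryTheory in
lemma ker_pd_iff (R : Type u) [Ring R] {P M : Type u} [AddCommGroup P] [Module R P]
    [AddCommGroup M] [Module R M] [Module.Projective R P] (f : P →ₗ[R] M)
    (hf : Function.Surjective f) (d : ℕ) :
    HasProjectiveDimensionLE (ModuleCat.of R M) (d + 1) ↔
      HasProjectiveDimensionLE (ModuleCat.of R (LinearMap.ker f)) d :=
  (LinearMap.shortExact_shortComplexKer hf).hasProjectiveDimensionLT_X₃_iff d
    (ModuleCat.projective_of_categoryTheory_projective (ModuleCat.of R P))

open CategoryTheory in
lemma projDimLE_iff (R : Type u) [Ring R] (d : ℕ) :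
    ∀ (M : Type u) [AddCommGroup M] [Module R M],
    ProjDimLE R d M ↔ HasProjectiveDimensionLE (ModuleCat.of R M) d := by
  induction d with
  | zero =>
    intro M _ _
    rw [← projective_iff_hasProjectiveDimensionLE_zero, ← IsProjective.iff_projective]
    rfl
  | succ d ih =>
    intro M _ _
    constructor
    · rintro ⟨ι, f, hf, h⟩
      rw [ker_pd_iff R f hf, ← ih]
      exact h
    · intro h
      have hs : Function.Surjective (Finsupp.linearCombination R (id : M → M)) :=
        Finsupp.linearCombination_id_surjective R M
      refine ⟨M, Finsupp.linearCombination R (id : M → M), hs, ?_⟩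
      rw [ih, ← ker_pd_iff R _ hs]
      exact h

lemma projDimLE_ker_iff (R : Type u) [Ring R] {P M : Type u} [AddCommGroup P] [Module R P]
    [AddCommGroup M] [Module R M] [Module.Projective R P] (f : P →ₗ[R] M)
    (hf : Function.Surjective f) (d : ℕ) :
    ProjDimLE R (d + 1) M ↔ ProjDimLE R d (LinearMap.ker f) := by
  rw [projDimLE_iff, projDimLE_iff, ker_pd_iff R f hf]

lemma projDimLE'_ker_iff (R : Type u) [Ring R] {P M : Type u} [AddCommGroup P] [Module R P]
    [AddCommGroup M] [Module R M] [Module.Projective R P] (f : P →ₗ[R] M)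
    (hf : Function.Surjective f) (d : ℕ∞) (hd : 1 ≤ d) :
    ProjDimLE' R d M ↔ ProjDimLE' R (d - 1) (LinearMap.ker f) := by
  obtain ⟨c, rfl⟩ : ∃ c, d = c + 1 := ⟨d - 1, (tsub_add_cancel_of_le hd).symm⟩
  have hc : c + 1 - 1 = c := by
    induction c using ENat.recTopCoe with
    | top => rfl
    | coe a => norm_cast
  rw [hc]
  constructor
  · rintro h k rfl
    rw [← projDimLE_ker_iff R f hf]
    exact h _ (by push_cast; rfl)
  · intro h k hk
    obtain _ | k := k
    · simp at hk
      exact absurd hk.symm (by simp)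
    · rw [projDimLE_ker_iff R f hf]
      refine h k ?_
      push_cast at hk
      exact (ENat.add_left_injective_of_ne_top ENat.one_ne_top) hk

open CategoryTheory in
lemma projDimLE'_equiv (R : Type u) [Ring R] {M N : Type u} [AddCommGroup M] [Module R M]
    [AddCommGroup N] [Module R N] (e : M ≃ₗ[R] N) (d : ℕ∞) (h : ProjDimLE' R d M) :
    ProjDimLE' R d N := by
  intro k hk
  have := h k hk
  rw [projDimLE_iff] at this ⊢
  exact hasProjectiveDimensionLT_of_iso e.toModuleIso _

lemma finNPres_equiv (R : Type u) [Ring R] {M N : Type u} [AddCommGroup M] [Module R M]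
    [AddCommGroup N] [Module R N] (e : M ≃ₗ[R] N) (n : ℕ) (h : FinNPres R n M) :
    FinNPres R n N := by
  cases n with
  | zero =>
    have : Module.Finite R M := h
    exact Module.Finite.equiv e
  | succ n =>
    obtain ⟨k, f, hf, h⟩ := h
    refine ⟨k, e.toLinearMap ∘ₗ f, e.surjective.comp hf, ?_⟩
    rw [LinearEquiv.ker_comp]
    exact h

lemma finNPres_finite (R : Type u) [Ring R] {M : Type u} [AddCommGroup M] [Module R M]
    (n : ℕ) (h : FinNPres R n M) : Module.Finite R M := by
  cases n with
  | zero => exact h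
  | succ n =>
    obtain ⟨k, f, hf, h⟩ := h
    exact Module.Finite.of_surjective f hf

/-- If Ext¹(P/N, E) = 0 then maps N → E extend to P (pushout). -/
lemma Ext1Zero.extend (R : Type u) [Ring R] {P E : Type u} [AddCommGroup P] [Module R P]
    [AddCommGroup E] [Module R E] (N : Submodule R P) (H : Ext1Zero R (P ⧸ N) E)
    (h : N →ₗ[R] E) : ∃ g : P →ₗ[R] E, g ∘ₗ N.subtype = h := by
  let W : Submodule R (E × P) := LinearMap.range (h.prod (-N.subtype))
  let p : ((E × P) ⧸ W) →ₗ[R] (P ⧸ N) := W.liftQ (N.mkQ ∘ₗ LinearMap.snd R E P) (by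
    rintro _ ⟨x, rfl⟩
    simp)
  obtain ⟨r, hr⟩ := H ((E × P) ⧸ W) (W.mkQ ∘ₗ LinearMap.inl R E P) p
    (by
      rw [← LinearMap.ker_eq_bot, LinearMap.ker_eq_bot']
      intro e he
      have he' : ((e, 0) : E × P) ∈ W := by simpa using he
      obtain ⟨x, hx⟩ := he'
      have h2 : (x : P) = 0 := by simpa using congrArg Prod.snd hx
      have h3 : x = 0 := Subtype.ext h2
      have h1 : h x = e := congrArg Prod.fst hx
      rw [← h1, h3, map_zero])
    (by
      intro y
      obtain ⟨y, rfl⟩ := N.mkQ_surjective y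
      exact ⟨W.mkQ (0, y), by simp [p]⟩)
    (by
      ext z
      obtain ⟨⟨e, y⟩, rfl⟩ := W.mkQ_surjective z
      constructor
      · rintro ⟨e', he'⟩
        rw [← he']
        simp [p]
      · intro hz
        have hy : y ∈ N := by simpa [p] using hz
        refine ⟨e + h ⟨y, hy⟩, ?_⟩
        simp only [LinearMap.comp_apply, LinearMap.inl_apply, Submodule.mkQ_apply]
        rw [Submodule.Quotient.eq]
        exact ⟨⟨y, hy⟩, by simp⟩)
  refine ⟨r ∘ₗ W.mkQ ∘ₗ LinearMap.inr R E P, ?_⟩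
  ext x
  have h1 : W.mkQ (0, (x : P)) = W.mkQ (h x, 0) := by
    simp only [Submodule.mkQ_apply]
    rw [Submodule.Quotient.eq]
    exact ⟨-x, by simp⟩
  have h2 := LinearMap.congr_fun hr (h x)
  simp only [LinearMap.comp_apply, LinearMap.inl_apply, LinearMap.inr_apply, LinearMap.id_apply,
    Submodule.subtype_apply] at h2 ⊢
  rw [h1, h2]

lemma ext1Zero_of_extend (R : Type u) [Ring R] {P K E : Type u} [AddCommGroup P] [Module R P]
    [AddCommGroup E] [Module R E] [AddCommGroup K] [Module R K] [Module.Projective R P]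
    (f : P →ₗ[R] K) (hf : Function.Surjective f)
    (H : ∀ h : LinearMap.ker f →ₗ[R] E, ∃ g : P →ₗ[R] E, g ∘ₗ (LinearMap.ker f).subtype = h) :
    Ext1Zero R K E := by
  intro X _ _ i p hi hp hip
  obtain ⟨l, hl⟩ := Module.projective_lifting_property p f hp
  let ei := LinearEquiv.ofInjective i hi
  have hei : ∀ y, i (ei.symm y) = y := fun y => congrArg Subtype.val (ei.apply_symm_apply y)
  have hl' : ∀ y, p (l y) = f y := fun y => LinearMap.congr_fun hl y
  have hpi : ∀ e, p (i e) = 0 := fun e => by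
    have : i e ∈ LinearMap.ker p := hip ▸ LinearMap.mem_range_self i e
    exact this
  obtain ⟨g, hg⟩ := H (ei.symm.toLinearMap ∘ₗ LinearMap.codRestrict (LinearMap.range i)
    (l ∘ₗ (LinearMap.ker f).subtype) (fun x => by
      rw [hip]
      simp [hl']))
  let l2 : P →ₗ[R] X := l - i ∘ₗ g
  have hl2 : LinearMap.ker f ≤ LinearMap.ker l2 := by
    intro x hx
    have := LinearMap.congr_fun hg ⟨x, hx⟩
    simp only [LinearMap.comp_apply, Submodule.subtype_apply, LinearEquiv.coe_coe] at this
    simp only [l2, LinearMap.mem_ker, LinearMap.sub_apply, LinearMap.comp_apply]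
    rw [this, hei]
    simp
  let s : K →ₗ[R] X := (LinearMap.ker f).liftQ l2 hl2 ∘ₗ
    (f.quotKerEquivOfSurjective hf).symm.toLinearMap
  have hs : ∀ y, s (f y) = l2 y := by
    intro y
    have : (f.quotKerEquivOfSurjective hf).symm (f y) = (LinearMap.ker f).mkQ y := by
      rw [LinearEquiv.symm_apply_eq]
      rfl
    simp [s, this]
  have hps : ∀ k, p (s k) = k := by
    intro k
    obtain ⟨y, rfl⟩ := hf k
    rw [hs]
    simp [l2, hl', hpi]
  refine ⟨ei.symm.toLinearMap ∘ₗ LinearMap.codRestrict (LinearMap.range i)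
    (LinearMap.id - s ∘ₗ p) (fun x => by
      rw [hip]
      simp [hps]), ?_⟩
  ext e
  apply hi
  simp [hei, hpi]

lemma finite_sub_proj (R : Type u) [Ring R] {P : Type u} [AddCommGroup P] [Module R P]
    [hP : Module.Projective R P] (N : Submodule R P) (hN : N.FG) :
    ∃ (k : ℕ) (φ : P →ₗ[R] (Fin k → R)) (π : (Fin k → R) →ₗ[R] P), ∀ x ∈ N, π (φ x) = x := by
  classical
  obtain ⟨s, hs⟩ := hP.out
  obtain ⟨T, rfl⟩ := hN
  let S : Finset P := T.biUnion (fun t => (s t).support)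
  let φ : P →ₗ[R] (Fin S.card → R) :=
    LinearMap.pi (fun j => Finsupp.lapply (S.equivFin.symm j : P) ∘ₗ s)
  let π : (Fin S.card → R) →ₗ[R] P := Fintype.linearCombination R (fun j => (S.equivFin.symm j : P))
  refine ⟨S.card, φ, π, fun x hx => ?_⟩
  have : Submodule.span R (T : Set P) ≤ LinearMap.eqLocus (π ∘ₗ φ) LinearMap.id := by
    rw [Submodule.span_le]
    intro t ht
    change π (φ t) = t
    have h1 : π (φ t) = ∑ j, s t (S.equivFin.symm j : P) • (S.equivFin.symm j : P) := by
      simp [π, φ, Fintype.linearCombination_apply]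
    rw [h1, Equiv.sum_comp S.equivFin.symm (fun q : S => s t (q : P) • (q : P)),
      Finset.sum_coe_sort S (fun q => s t q • q)]
    have h2 := hs t
    rw [Finsupp.linearCombination_apply, Finsupp.sum] at h2
    refine Eq.trans (Eq.symm ?_) h2
    refine Finset.sum_subset (Finset.subset_biUnion_of_mem (fun t => (s t).support) ht) ?_
    intro q _ hq
    simp only [Finsupp.mem_support_iff, not_not] at hq
    simp [hq]
  exact this hx

/-- `E` is `FPₙ^{≤d}`-injective if and only if `Ext¹_R(P/N, E) = 0` for every projective
module `P` and every finitely `(n-1)`-presented submodule `N ⊆ P` of projective dimension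
at most `d-1`. -/
theorem fpdInj_iff_quotients_of_proj (R : Type u) [Ring R] (n : ℕ) (hn : 1 ≤ n)
    (d : ℕ∞) (hd : 1 ≤ d) (E : Type u) [AddCommGroup E] [Module R E] :
    FPdInj R n d E ↔
      ∀ (P : Type u) [AddCommGroup P] [Module R P], Module.Projective R P →
        ∀ (N : Submodule R P), FinNPres R (n - 1) N → ProjDimLE' R (d - 1) N →
          Ext1Zero R (P ⧸ N) E := by
  obtain ⟨n, rfl⟩ : ∃ m, n = m + 1 := ⟨n - 1, by omega⟩
  rw [Nat.add_sub_cancel]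
  constructor
  · intro H P _ _ hP N hN hd'
    have hfin := finNPres_finite R n hN
    obtain ⟨k, φ, π, hπ⟩ := finite_sub_proj R N (Module.Finite.iff_fg.1 hfin)
    have hinj : Function.Injective (φ ∘ₗ N.subtype) := by
      intro x y hxy
      have := congrArg π hxy
      simp only [LinearMap.comp_apply, Submodule.subtype_apply] at this
      rw [hπ _ x.2, hπ _ y.2] at this
      exact Subtype.ext this
    let N₀ : Submodule R (Fin k → R) := LinearMap.range (φ ∘ₗ N.subtype)
    let e : N ≃ₗ[R] N₀ := LinearEquiv.ofInjective _ hinj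
    have hker : LinearMap.ker N₀.mkQ = N₀ := Submodule.ker_mkQ N₀
    have hE : Ext1Zero R ((Fin k → R) ⧸ N₀) E := by
      apply H
      · refine ⟨k, N₀.mkQ, N₀.mkQ_surjective, ?_⟩
        rw [hker]
        exact finNPres_equiv R e n hN
      · rw [projDimLE'_ker_iff R N₀.mkQ N₀.mkQ_surjective d hd, hker]
        exact projDimLE'_equiv R e _ hd'
    refine ext1Zero_of_extend R N.mkQ N.mkQ_surjective ?_
    rw [Submodule.ker_mkQ]
    intro h
    obtain ⟨g, hg⟩ := hE.extend R N₀ (h ∘ₗ e.symm.toLinearMap)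
    refine ⟨g ∘ₗ φ, ?_⟩
    ext x
    have := LinearMap.congr_fun hg (e x)
    rw [LinearMap.comp_apply, LinearMap.comp_apply, LinearEquiv.coe_coe,
      LinearEquiv.symm_apply_apply] at this
    exact this
  · intro H K _ _ hK hKd
    obtain ⟨k, f, hf, hk⟩ := hK
    refine ext1Zero_of_extend R f hf (fun h => ?_)
    refine Ext1Zero.extend R _ (H _ inferInstance _ hk ?_) h
    exact (projDimLE'_ker_iff R f hf d hd).1 hKd
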